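/- Let 𝓔 : B(ℋ) → B(ℋ) be an ergodic quantum channel with peripheral spectrum {ω_ℓ = e^{2πiℓ/K} : ℓ = 0, …, K−1}. Then each peripheral spectral projection P_ℓ of 𝓔 has rank 1, and there exist operators R_ℓ, L_ℓ ∈ B(ℋ) such that P_ℓ = R_ℓ tr(L_ℓ† ·), 𝓔(R_ℓ) = ω_ℓ R_ℓ, 𝓔†(L_ℓ) = ω̄_ℓ L_ℓ (where 𝓔† is the adjoint of 𝓔 with respect to the Hilbert–Schmidt inner product), and tr(L_ℓ† R_{ℓ'}) = δ_{ℓℓ'} for all ℓ, ℓ' ∈ {0, …, K−1}. -/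

import Mathlib

open Matrix Kronecker
open scoped ComplexOrder
noncomputable section

abbrev MatC (n : ℕ) := Matrix (Fin n) (Fin n) ℂ

/-- The Choi-Jamiołkowski matrix of a linear map on matrices. -/
def choi {n : ℕ} (E : MatC n →ₗ[ℂ] MatC n) : Matrix (Fin n × Fin n) (Fin n × Fin n) ℂ :=
  fun p q => E (Matrix.single p.2 q.2 1) p.1 q.1

/-- A quantum channel: a completely positive (equivalently, with positive semidefinite
Choi matrix) and trace-preserving linear map. -/
def IsQuantumChannel {n : ℕ} (E : MatC n →ₗ[ℂ] MatC n) : Prop :=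
  (choi E).PosSemidef ∧ ∀ A : MatC n, (E A).trace = A.trace

/-- A channel is ergodic when its fixed-point space is one-dimensional. -/
def IsErgodic {n : ℕ} (E : MatC n →ₗ[ℂ] MatC n) : Prop :=
  Module.finrank ℂ (Module.End.eigenspace E 1) = 1


/-- `P` is the spectral projection of `E` associated with the eigenvalue `μ`: the projection
onto the generalized eigenspace of `μ` along the sum of all other generalized eigenspaces. -/
def IsSpectralProjection {n : ℕ} (E P : MatC n →ₗ[ℂ] MatC n) (μ : ℂ) : Prop :=
  P ∘ₗ P = P ∧
  LinearMap.range P = Module.End.maxGenEigenspace E μ ∧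
  LinearMap.ker P = ⨆ ν ∈ {ν : ℂ | ν ≠ μ}, Module.End.maxGenEigenspace E ν


section PolarPart
open scoped MatrixOrder Matrix.Norms.L2Operator

lemma polar_aux {n : ℕ} (R : MatC n) :
    ∃ U H : MatC n, H.PosSemidef ∧ Uᴴ * U = 1 ∧ R = U * H := by
  have hRR : (0 : MatC n) ≤ Rᴴ * R := by
    rw [Matrix.nonneg_iff_posSemidef]; exact Matrix.posSemidef_conjTranspose_mul_self R
  obtain ⟨H, hH, hHH⟩ : ∃ H : MatC n, H.PosSemidef ∧ H * H = Rᴴ * R :=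
    ⟨CFC.sqrt (Rᴴ * R), by rw [← Matrix.nonneg_iff_posSemidef]; exact CFC.sqrt_nonneg _,
      CFC.sqrt_mul_sqrt_self _ hRR⟩
  have hHt : Hᴴ = H := hH.isHermitian
  let h := Matrix.toEuclideanLin (𝕜 := ℂ) H
  let r := Matrix.toEuclideanLin (𝕜 := ℂ) R
  have key : ∀ A : MatC n, ∀ x, ‖Matrix.toEuclideanLin (𝕜 := ℂ) A x‖ ^ 2
      = RCLike.re (inner ℂ x (Matrix.toEuclideanLin (𝕜 := ℂ) (Aᴴ * A) x)) := by
    intro A x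
    have e : Matrix.toEuclideanLin (𝕜 := ℂ) (Aᴴ * A) x =
        (Matrix.toEuclideanLin (𝕜 := ℂ) Aᴴ) (Matrix.toEuclideanLin (𝕜 := ℂ) A x) := by
      ext i; simp [Matrix.toLpLin_apply]
    rw [e, Matrix.toEuclideanLin_conjTranspose_eq_adjoint, LinearMap.adjoint_inner_right,
      inner_self_eq_norm_sq]
  have hnorm : ∀ x, ‖h x‖ = ‖r x‖ := by
    intro x
    have h1 := key H x
    have h2 := key R x
    rw [hHt, hHH, ← h2] at h1
    exact (sq_eq_sq₀ (norm_nonneg _) (norm_nonneg _)).1 h1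
  obtain ⟨s, hs⟩ := LinearMap.exists_rightInverse_of_surjective h.rangeRestrict
    (LinearMap.range_rangeRestrict h)
  have hs' : ∀ y : LinearMap.range h, h (s y) = y := fun y => by
    have := LinearMap.congr_fun hs y
    exact congrArg Subtype.val this
  let L : LinearMap.range h →ₗᵢ[ℂ] EuclideanSpace ℂ (Fin n) :=
    { toLinearMap := r ∘ₗ s
      norm_map' := fun y => by
        show ‖r (s y)‖ = ‖y‖
        rw [← hnorm, hs']; rfl }
  have hL : ∀ x, L ⟨h x, x, rfl⟩ = r x := by
    intro x
    show r (s ⟨h x, x, rfl⟩) = r x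
    rw [← sub_eq_zero, ← map_sub, ← norm_eq_zero, ← hnorm, map_sub, hs']
    simp
  let V := L.extend
  have hV : ∀ x, V (h x) = r x := fun x => by
    rw [← hL x]; exact L.extend_apply ⟨h x, x, rfl⟩
  let U : MatC n := (Matrix.toEuclideanLin (𝕜 := ℂ)).symm V.toLinearMap
  have hU : Matrix.toEuclideanLin (𝕜 := ℂ) U = V.toLinearMap := by simp [U]
  refine ⟨U, H, hH, ?_, ?_⟩
  · apply (Matrix.toEuclideanLin (𝕜 := ℂ) (m := Fin n) (n := Fin n)).injective
    have e : Matrix.toEuclideanLin (𝕜 := ℂ) (Uᴴ * U) =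
        (Matrix.toEuclideanLin (𝕜 := ℂ) Uᴴ) ∘ₗ (Matrix.toEuclideanLin (𝕜 := ℂ) U) := by
      ext i; simp [Matrix.toLpLin_apply]
    rw [e, Matrix.toEuclideanLin_conjTranspose_eq_adjoint, hU]
    ext1 x
    refine ext_inner_left ℂ fun y => ?_
    have e1 : Matrix.toEuclideanLin (𝕜 := ℂ) (1 : MatC n) x = x := by
      ext i; simp [Matrix.toLpLin_apply]
    rw [e1, LinearMap.comp_apply, LinearMap.adjoint_inner_right]
    exact V.inner_map_map y x
  · apply (Matrix.toEuclideanLin (𝕜 := ℂ) (m := Fin n) (n := Fin n)).injective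
    have e : Matrix.toEuclideanLin (𝕜 := ℂ) (U * H) =
        (Matrix.toEuclideanLin (𝕜 := ℂ) U) ∘ₗ (Matrix.toEuclideanLin (𝕜 := ℂ) H) := by
      ext i; simp [Matrix.toLpLin_apply]
    rw [e, hU]
    ext1 x
    exact (hV x).symm

lemma psd_factor {ι : Type*} [Fintype ι] [DecidableEq ι] {H : Matrix ι ι ℂ} (hH : H.PosSemidef) :
    ∃ B : Matrix ι ι ℂ, H = Bᴴ * B := by
  refine ⟨CFC.sqrt H, ?_⟩
  have h0 : (0 : Matrix ι ι ℂ) ≤ H := Matrix.nonneg_iff_posSemidef.2 hH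
  have h1 : (CFC.sqrt H).PosSemidef := by
    rw [← Matrix.nonneg_iff_posSemidef]; exact CFC.sqrt_nonneg _
  have h2 : (CFC.sqrt H)ᴴ = CFC.sqrt H := h1.isHermitian
  rw [h2, CFC.sqrt_mul_sqrt_self _ h0]

lemma span_psd {n : ℕ} : Submodule.span ℂ {A : MatC n | A.PosSemidef} = ⊤ := by
  have := CStarAlgebra.span_nonneg (A := MatC n)
  simpa [Matrix.nonneg_iff_posSemidef] using this

end PolarPart

lemma kraus_exists {n : ℕ} (E : MatC n →ₗ[ℂ] MatC n) (hE : (choi E).PosSemidef) :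
    ∃ κ : (Fin n × Fin n) → MatC n, ∀ X, E X = ∑ s, κ s * X * (κ s)ᴴ := by
  obtain ⟨B, hB⟩ := psd_factor hE
  refine ⟨fun s => Matrix.of fun i k => star (B s (i, k)), fun X => ?_⟩
  have hs : ∀ k l i j, E (Matrix.single k l 1) i j = ∑ s, star (B s (i, k)) * B s (j, l) := by
    intro k l i j
    have := congrFun (congrFun hB (i, k)) (j, l)
    simpa [choi, Matrix.mul_apply] using this
  have hX : E X = ∑ k, ∑ l, X k l • E (Matrix.single k l 1) := by
    conv_lhs => rw [Matrix.matrix_eq_sum_single X]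
    simp only [map_sum]
    refine Finset.sum_congr rfl fun k _ => Finset.sum_congr rfl fun l _ => ?_
    rw [← map_smul]; simp
  rw [hX]
  ext i j
  simp only [Matrix.sum_apply, Matrix.smul_apply, hs, Matrix.mul_apply, Matrix.of_apply,
    Matrix.conjTranspose_apply, star_star, smul_eq_mul, Finset.mul_sum, Finset.sum_mul]
  rw [Finset.sum_comm]
  conv_rhs => rw [Finset.sum_comm]
  refine Finset.sum_congr rfl fun l _ => ?_
  conv_rhs => rw [Finset.sum_comm]
  refine Finset.sum_congr rfl fun k _ => Finset.sum_congr rfl fun s _ => ?_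
  ring

lemma kraus_star {n : ℕ} {E : MatC n →ₗ[ℂ] MatC n} {κ : (Fin n × Fin n) → MatC n}
    (hκ : ∀ X, E X = ∑ s, κ s * X * (κ s)ᴴ) (X : MatC n) : E Xᴴ = (E X)ᴴ := by
  rw [hκ, hκ, Matrix.conjTranspose_sum]
  refine Finset.sum_congr rfl fun s _ => ?_
  simp [Matrix.mul_assoc]

lemma abs_fixed {n : ℕ} {E : MatC n →ₗ[ℂ] MatC n} {κ : (Fin n × Fin n) → MatC n}
    (hκ : ∀ X, E X = ∑ s, κ s * X * (κ s)ᴴ) (hT : ∀ A : MatC n, (E A).trace = A.trace)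
    {U H : MatC n} (hH : H.PosSemidef) (hU : Uᴴ * U = 1) {lam : ℂ} (hlam : ‖lam‖ = 1)
    (hE : E (U * H) = lam • (U * H)) : E H = H := by
  obtain ⟨B, hB⟩ := psd_factor hH
  have hHt : Hᴴ = H := hH.isHermitian
  have hll : star lam * lam = 1 := by
    have := Complex.conj_mul' lam
    rw [hlam] at this; simpa using this
  obtain ⟨W, hW⟩ : ∃ W : MatC n, W = lam • U := ⟨_, rfl⟩
  have hWW : Wᴴ * W = 1 := by
    rw [hW, Matrix.conjTranspose_smul, Matrix.smul_mul, Matrix.mul_smul, smul_smul, hll, hU,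
      one_smul]
  have hWW' : W * Wᴴ = 1 := mul_eq_one_comm.1 hWW
  have hE' : E (U * H) = W * H := by rw [hE, hW, Matrix.smul_mul]
  have hE'' : E (H * Uᴴ) = H * Wᴴ := by
    have := kraus_star hκ (U * H)
    rw [hE', Matrix.conjTranspose_mul, Matrix.conjTranspose_mul, hHt] at this
    exact this
  let D : (Fin n × Fin n) → MatC n := fun s => Wᴴ * κ s * U - κ s
  have hsum : ∑ s, D s * H * (D s)ᴴ = Wᴴ * E (U * H * Uᴴ) * W - H - H + E H := by
    have e1 : H = Wᴴ * E (U * H) := by rw [hE', ← Matrix.mul_assoc, hWW, Matrix.one_mul]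
    have e2 : H = E (H * Uᴴ) * W := by rw [hE'', Matrix.mul_assoc, hWW, Matrix.mul_one]
    have : Wᴴ * E (U * H * Uᴴ) * W - H - H + E H
        = Wᴴ * E (U * H * Uᴴ) * W - Wᴴ * E (U * H) - E (H * Uᴴ) * W + E H := by
      rw [← e1, ← e2]
    rw [this, hκ, hκ, hκ, hκ]
    simp only [Finset.mul_sum, Finset.sum_mul, ← Finset.sum_sub_distrib, ← Finset.sum_add_distrib]
    refine Finset.sum_congr rfl fun s _ => ?_
    simp only [D, Matrix.conjTranspose_sub, Matrix.conjTranspose_mul,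
      Matrix.conjTranspose_conjTranspose]
    noncomm_ring
  have htr : (∑ s, D s * H * (D s)ᴴ).trace = 0 := by
    rw [hsum, Matrix.trace_add, Matrix.trace_sub, Matrix.trace_sub, hT,
      Matrix.trace_mul_cycle, hWW', Matrix.one_mul, hT, Matrix.trace_mul_cycle, hU,
      Matrix.one_mul]
    ring
  have hD : ∀ s, D s * Bᴴ = 0 := by
    have e : ∀ s, D s * H * (D s)ᴴ = (D s * Bᴴ) * (D s * Bᴴ)ᴴ := by
      intro s
      rw [hB]; simp [Matrix.mul_assoc]
    simp only [e, Matrix.trace_sum] at htr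
    rw [Finset.sum_eq_zero_iff_of_nonneg
      (fun s _ => (Matrix.posSemidef_self_mul_conjTranspose (D s * Bᴴ)).trace_nonneg)] at htr
    intro s
    exact Matrix.trace_mul_conjTranspose_self_eq_zero_iff.1 (htr s (Finset.mem_univ s))
  have h0 : ∑ s, D s * H * (κ s)ᴴ = 0 := by
    refine Finset.sum_eq_zero fun s _ => ?_
    rw [hB, ← Matrix.mul_assoc (D s), hD]; simp
  have h1 : ∑ s, D s * H * (κ s)ᴴ = Wᴴ * E (U * H) - E H := by
    rw [hκ, hκ, Finset.mul_sum, ← Finset.sum_sub_distrib]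
    refine Finset.sum_congr rfl fun s _ => ?_
    simp only [D]
    noncomm_ring
  rw [h1, hE', ← Matrix.mul_assoc, hWW, Matrix.one_mul, sub_eq_zero] at h0
  exact h0.symm

/-- Peripheral eigenvectors are, in modulus, multiples of the stationary state. -/
lemma exists_state {n : ℕ} {E : MatC n →ₗ[ℂ] MatC n}
    (hE : IsQuantumChannel E) (hErg : IsErgodic E) :
    ∃ G : MatC n, ∀ lam : ℂ, ‖lam‖ = 1 → ∀ S : MatC n, E S = lam • S →
      (∃ c : ℂ, Sᴴ * S = c • G) ∧ (∃ c : ℂ, S * Sᴴ = c • G) := by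
  obtain ⟨κ, hκ⟩ := kraus_exists E hE.1
  obtain ⟨v, -, hv⟩ := finrank_eq_one_iff'.1 hErg
  have main : ∀ lam : ℂ, ‖lam‖ = 1 → ∀ S : MatC n, E S = lam • S →
      (∃ c : ℂ, Sᴴ * S = c • ((v : MatC n) * v)) := by
    intro lam hlam S hS
    obtain ⟨U, H, hH, hU, rfl⟩ := polar_aux S
    have hfix := abs_fixed hκ hE.2 hH hU hlam hS
    obtain ⟨c, hc⟩ := hv ⟨H, by rw [Module.End.mem_eigenspace_iff, hfix, one_smul]⟩
    have hc' : c • (v : MatC n) = H := congrArg Subtype.val hc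
    refine ⟨c * c, ?_⟩
    have hHt : Hᴴ = H := hH.isHermitian
    rw [Matrix.conjTranspose_mul, hHt, Matrix.mul_assoc, ← Matrix.mul_assoc Uᴴ, hU,
      Matrix.one_mul, ← hc', Matrix.smul_mul, Matrix.mul_smul, smul_smul]
  refine ⟨(v : MatC n) * v, fun lam hlam S hS => ⟨main lam hlam S hS, ?_⟩⟩
  have := main (star lam) (by simpa using hlam) Sᴴ
    (by rw [kraus_star hκ, hS, Matrix.conjTranspose_smul])
  simpa using this

lemma peripheral_simple {n : ℕ} {E : MatC n →ₗ[ℂ] MatC n}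
    (hE : IsQuantumChannel E) (hErg : IsErgodic E) {lam : ℂ} (hlam : ‖lam‖ = 1)
    {R S : MatC n} (hR0 : R ≠ 0) (hR : E R = lam • R) (hS : E S = lam • S) :
    ∃ c : ℂ, c • R = S := by
  obtain ⟨G, hG⟩ := exists_state hE hErg
  have mem : ∀ X : MatC n, E X = lam • X → Xᴴ * X ∈ Submodule.span ℂ {G} := fun X hX => by
    obtain ⟨c, hc⟩ := (hG lam hlam X hX).1
    rw [hc]; exact Submodule.smul_mem _ _ (Submodule.mem_span_singleton_self G)
  have m1 := mem R hR
  have m2 := mem S hS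
  have m3 := mem (R + S) (by rw [map_add, hR, hS, smul_add])
  have m4 := mem (R + Complex.I • S) (by
    rw [map_add, map_smul, hR, hS, smul_add, smul_comm])
  have m5 : Rᴴ * S ∈ Submodule.span ℂ {G} := by
    have e : Rᴴ * S = (1 / 2 : ℂ) • (((R + S)ᴴ * (R + S) - Rᴴ * R - Sᴴ * S)
        - Complex.I • ((R + Complex.I • S)ᴴ * (R + Complex.I • S) - Rᴴ * R - Sᴴ * S)) := by
      simp only [Matrix.conjTranspose_add, Matrix.conjTranspose_smul, Matrix.add_mul,
        Matrix.mul_add, Matrix.smul_mul, Matrix.mul_smul, Complex.star_def, Complex.conj_I]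
      match_scalars <;> ring_nf <;> simp <;> norm_num
    rw [e]
    exact Submodule.smul_mem _ _ (Submodule.sub_mem _
      (Submodule.sub_mem _ (Submodule.sub_mem _ m3 m1) m2)
      (Submodule.smul_mem _ _ (Submodule.sub_mem _ (Submodule.sub_mem _ m4 m1) m2)))
  obtain ⟨c, hc⟩ := Submodule.mem_span_singleton.1 m5
  obtain ⟨d, hd⟩ := Submodule.mem_span_singleton.1 m1
  have hRR : Rᴴ * R ≠ 0 := fun h => hR0 (Matrix.conjTranspose_mul_self_eq_zero.1 h)
  have hd0 : d ≠ 0 := by rintro rfl; exact hRR (by rw [← hd, zero_smul])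
  have hG0 : G ≠ 0 := by rintro rfl; exact hRR (by rw [← hd, smul_zero])
  refine ⟨c / d, ?_⟩
  by_contra hne
  have hS'0 : S - (c / d) • R ≠ 0 := fun h => hne (sub_eq_zero.1 h).symm
  have hS' : E (S - (c / d) • R) = lam • (S - (c / d) • R) := by
    rw [map_sub, map_smul, hR, hS, smul_sub, smul_comm]
  have horth : Rᴴ * (S - (c / d) • R) = 0 := by
    rw [Matrix.mul_sub, Matrix.mul_smul, ← hc, ← hd, smul_smul, div_mul_cancel₀ _ hd0, sub_self]
  generalize S - (c / d) • R = T at hS'0 hS' horth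
  obtain ⟨f, hf⟩ := (hG lam hlam R hR).2
  obtain ⟨e, he⟩ := (hG lam hlam T hS').2
  have hf0 : f ≠ 0 := by
    rintro rfl; rw [zero_smul] at hf
    exact hR0 (Matrix.self_mul_conjTranspose_eq_zero.1 hf)
  have he0 : e ≠ 0 := by
    rintro rfl; rw [zero_smul] at he
    exact hS'0 (Matrix.self_mul_conjTranspose_eq_zero.1 he)
  have hz : (R * Rᴴ) * (T * Tᴴ) = 0 := by
    rw [Matrix.mul_assoc, ← Matrix.mul_assoc Rᴴ, horth]; simp
  -- `T * Tᴴ` is a nonzero multiple of `R * Rᴴ`, so `(R * Rᴴ) ^ 2 = 0`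
  have hz2 : (R * Rᴴ)ᴴ * (R * Rᴴ) = 0 := by
    rw [hf, he, Matrix.smul_mul, Matrix.mul_smul] at hz
    have hGG : G * G = 0 := by
      rcases smul_eq_zero.1 hz with h | h
      · exact absurd h hf0
      · rcases smul_eq_zero.1 h with h | h
        · exact absurd h he0
        · exact h
    rw [Matrix.conjTranspose_mul, Matrix.conjTranspose_conjTranspose, hf, Matrix.smul_mul,
      Matrix.mul_smul, hGG]; simp
  exact hR0 (Matrix.self_mul_conjTranspose_eq_zero.1 (Matrix.conjTranspose_mul_self_eq_zero.1 hz2))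

lemma psd_entry_le {n : ℕ} {A : MatC n} (hA : A.PosSemidef) (i j : Fin n) :
    ‖A i j‖ ≤ A.trace.re := by
  obtain ⟨B, rfl⟩ := psd_factor hA
  have hd : ∀ k, ((Bᴴ * B) k k).re = ∑ s, ‖B s k‖ ^ 2 := by
    intro k
    simp only [Matrix.mul_apply, Matrix.conjTranspose_apply, Complex.re_sum]
    refine Finset.sum_congr rfl fun s _ => ?_
    rw [Complex.star_def, Complex.conj_mul', ← Complex.ofReal_pow, Complex.ofReal_re]
  have hk : ∀ k, ∑ s, ‖B s k‖ ^ 2 ≤ (Bᴴ * B).trace.re := by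
    intro k
    rw [Matrix.trace, Complex.re_sum]
    simp only [Matrix.diag_apply, hd]
    exact Finset.single_le_sum (f := fun k => ∑ s, ‖B s k‖ ^ 2)
      (fun k _ => Finset.sum_nonneg fun s _ => sq_nonneg _) (Finset.mem_univ k)
  have h1 : ‖(Bᴴ * B) i j‖ ≤ ∑ s, (‖B s i‖ ^ 2 + ‖B s j‖ ^ 2) / 2 := by
    rw [Matrix.mul_apply]
    refine (norm_sum_le _ _).trans (Finset.sum_le_sum fun s _ => ?_)
    rw [norm_mul, Matrix.conjTranspose_apply, norm_star]
    nlinarith [sq_nonneg (‖B s i‖ - ‖B s j‖)]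
  rw [← Finset.sum_div, Finset.sum_add_distrib] at h1
  linarith [hk i, hk j]

lemma orbit_bdd {n : ℕ} {E : MatC n →ₗ[ℂ] MatC n} (hE : IsQuantumChannel E) (X : MatC n) :
    ∃ C : ℝ, ∀ (k : ℕ) (i j : Fin n), ‖(E ^ k) X i j‖ ≤ C := by
  obtain ⟨κ, hκ⟩ := kraus_exists E hE.1
  have hX : X ∈ Submodule.span ℂ {A : MatC n | A.PosSemidef} := by rw [span_psd]; trivial
  induction hX using Submodule.span_induction with
  | mem A hA =>
    have h : ∀ k : ℕ, ((E ^ k) A).PosSemidef ∧ ((E ^ k) A).trace = A.trace := by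
      intro k
      induction k with
      | zero => exact ⟨hA, rfl⟩
      | succ k ih =>
        rw [pow_succ', Module.End.mul_apply]
        refine ⟨?_, by rw [hE.2, ih.2]⟩
        rw [hκ]
        exact Matrix.posSemidef_sum _ fun s _ => ih.1.mul_mul_conjTranspose_same _
    exact ⟨A.trace.re, fun k i j => (h k).2 ▸ psd_entry_le (h k).1 i j⟩
  | zero => exact ⟨0, fun k i j => by simp⟩
  | add A B _ _ hA hB =>
    obtain ⟨a, ha⟩ := hA
    obtain ⟨b, hb⟩ := hB
    exact ⟨a + b, fun k i j => by
      rw [map_add, Matrix.add_apply]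
      exact (norm_add_le _ _).trans (add_le_add (ha k i j) (hb k i j))⟩
  | smul c A _ hA =>
    obtain ⟨a, ha⟩ := hA
    exact ⟨‖c‖ * a, fun k i j => by
      rw [map_smul, Matrix.smul_apply, norm_smul]
      exact mul_le_mul_of_nonneg_left (ha k i j) (norm_nonneg _)⟩

lemma no_jordan {n : ℕ} {E : MatC n →ₗ[ℂ] MatC n} (hE : IsQuantumChannel E)
    {lam : ℂ} (hlam : ‖lam‖ = 1) {x y : MatC n} (hx : E x = lam • x + y) (hy : E y = lam • y) :
    y = 0 := by
  obtain ⟨C, hC⟩ := orbit_bdd hE x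
  have hk : ∀ k : ℕ, lam • (E ^ k) x = lam ^ (k + 1) • x + ((k : ℂ) * lam ^ k) • y := by
    intro k
    induction k with
    | zero => simp
    | succ k ih =>
      rw [pow_succ', Module.End.mul_apply, ← map_smul, ih, map_add, map_smul, map_smul, hx, hy]
      push_cast
      module
  ext i j
  by_contra hne
  have hpos : 0 < ‖y i j‖ := norm_pos_iff.2 hne
  obtain ⟨k, hk'⟩ := exists_nat_gt ((C + ‖x i j‖) / ‖y i j‖)
  rw [div_lt_iff₀ hpos] at hk'
  have h1 := congrFun (congrFun (hk k) i) j
  simp only [Matrix.smul_apply, Matrix.add_apply, smul_eq_mul] at h1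
  have h2 : (k : ℂ) * lam ^ k * y i j = lam * (E ^ k) x i j - lam ^ (k + 1) * x i j := by
    rw [h1]; ring
  have h3 := congrArg norm h2
  have h4 := norm_sub_le (lam * (E ^ k) x i j) (lam ^ (k + 1) * x i j)
  rw [← h3] at h4
  simp only [norm_mul, norm_pow, hlam, one_pow, one_mul, mul_one, Complex.norm_natCast] at h4
  linarith [hC k i j]

lemma maxGen_eq {n : ℕ} {E : MatC n →ₗ[ℂ] MatC n} (hE : IsQuantumChannel E)
    {lam : ℂ} (hlam : ‖lam‖ = 1) {x : MatC n} (hx : x ∈ Module.End.maxGenEigenspace E lam) :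
    E x = lam • x := by
  rw [Module.End.mem_maxGenEigenspace] at hx
  obtain ⟨k, hk⟩ := hx
  induction k generalizing x with
  | zero => simp at hk; simp [hk]
  | succ k ih =>
    rw [pow_succ, Module.End.mul_apply] at hk
    have h1 := ih hk
    have h2 : (E - lam • (1 : Module.End ℂ (MatC n))) x = 0 := by
      refine no_jordan hE hlam (x := x) ?_ h1
      simp
    simpa [sub_eq_zero] using h2

lemma trace_rep {n : ℕ} (f : MatC n →ₗ[ℂ] ℂ) : ∃ L : MatC n, ∀ A, f A = (Lᴴ * A).trace := by
  refine ⟨Matrix.of fun i j => star (f (Matrix.single i j 1)), fun A => ?_⟩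
  have hX : f A = ∑ k, ∑ l, A k l * f (Matrix.single k l 1) := by
    conv_lhs => rw [Matrix.matrix_eq_sum_single A]
    simp only [map_sum]
    refine Finset.sum_congr rfl fun k _ => Finset.sum_congr rfl fun l _ => ?_
    rw [← smul_eq_mul, ← map_smul]; simp
  rw [hX, Finset.sum_comm]
  simp [Matrix.trace, Matrix.mul_apply, mul_comm]

/-- **Spectral structure of an ergodic quantum channel (part 2).**
For an ergodic quantum channel with peripheral spectrum `{ω_ℓ = e^{2πiℓ/K}}`, every
peripheral spectral projection `P_ℓ` has rank one, and there are operators `R_ℓ`, `L_ℓ`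
with `P_ℓ = R_ℓ tr(L_ℓ† ·)`, `𝓔(R_ℓ) = ω_ℓ R_ℓ`, `𝓔†(L_ℓ) = ω̄_ℓ L_ℓ` (the adjoint being
taken with respect to the Hilbert–Schmidt inner product, i.e.
`tr(L_ℓ† 𝓔(B)) = ω_ℓ tr(L_ℓ† B)` for all `B`), and `tr(L_ℓ† R_ℓ') = δ_{ℓℓ'}`. -/
theorem ergodic_peripheral_projections {n : ℕ} (E : MatC n →ₗ[ℂ] MatC n)
    (hE : IsQuantumChannel E) (hErg : IsErgodic E)
    (K : ℕ) (hK : 1 ≤ K) (ω : Fin K → ℂ)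
    (hω : ∀ ℓ : Fin K,
      ω ℓ = Complex.exp (2 * (Real.pi : ℂ) * Complex.I * ((ℓ : ℕ) : ℂ) / ((K : ℕ) : ℂ)))
    (hspec : {μ : ℂ | Module.End.HasEigenvalue E μ ∧ ‖μ‖ = 1} = Set.range ω)
    (P : Fin K → (MatC n →ₗ[ℂ] MatC n))
    (hP : ∀ ℓ, IsSpectralProjection E (P ℓ) (ω ℓ)) :
    (∀ ℓ, Module.finrank ℂ (LinearMap.range (P ℓ)) = 1) ∧
    ∃ R L : Fin K → MatC n,
      (∀ ℓ (A : MatC n), P ℓ A = ((L ℓ)ᴴ * A).trace • R ℓ) ∧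
      (∀ ℓ, E (R ℓ) = ω ℓ • R ℓ) ∧
      (∀ ℓ (B : MatC n), ((L ℓ)ᴴ * E B).trace = ω ℓ * ((L ℓ)ᴴ * B).trace) ∧
      (∀ ℓ ℓ', ((L ℓ)ᴴ * R ℓ').trace = if ℓ = ℓ' then 1 else 0) := by
  have hnorm : ∀ ℓ, ‖ω ℓ‖ = 1 := fun ℓ => by
    have : ω ℓ ∈ {μ : ℂ | Module.End.HasEigenvalue E μ ∧ ‖μ‖ = 1} := by
      rw [hspec]; exact ⟨ℓ, rfl⟩
    exact this.2
  have hev : ∀ ℓ, Module.End.HasEigenvalue E (ω ℓ) := fun ℓ => by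
    have : ω ℓ ∈ {μ : ℂ | Module.End.HasEigenvalue E μ ∧ ‖μ‖ = 1} := by
      rw [hspec]; exact ⟨ℓ, rfl⟩
    exact this.1
  have hinj : ∀ ℓ ℓ', ω ℓ = ω ℓ' → ℓ = ℓ' := by
    intro ℓ ℓ' h
    have hprim := Complex.isPrimitiveRoot_exp K (by omega)
    have e : ∀ m : Fin K, ω m = Complex.exp (2 * Real.pi * Complex.I / K) ^ (m : ℕ) := by
      intro m
      rw [hω, ← Complex.exp_nat_mul]; congr 1; ring
    rw [e, e] at h
    exact Fin.ext (hprim.pow_inj ℓ.2 ℓ'.2 h)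
  have hex : ∀ ℓ, ∃ R : MatC n, R ≠ 0 ∧ E R = ω ℓ • R := fun ℓ => by
    obtain ⟨v, hv⟩ := (hev ℓ).exists_hasEigenvector
    exact ⟨v, hv.2, hv.apply_eq_smul⟩
  choose R hR0 hR using hex
  have hrange : ∀ ℓ A, E (P ℓ A) = ω ℓ • P ℓ A := fun ℓ A => by
    refine maxGen_eq hE (hnorm ℓ) ?_
    rw [← (hP ℓ).2.1]; exact ⟨A, rfl⟩
  have hRm : ∀ ℓ, R ℓ ∈ Module.End.maxGenEigenspace E (ω ℓ) := fun ℓ =>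
    Module.End.eigenspace_le_maxGenEigenspace (Module.End.mem_eigenspace_iff.2 (hR ℓ))
  have hPR : ∀ ℓ, P ℓ (R ℓ) = R ℓ := fun ℓ => by
    have h1 := hRm ℓ
    rw [← (hP ℓ).2.1] at h1
    obtain ⟨A, hA⟩ := h1
    rw [← hA]; exact LinearMap.congr_fun (hP ℓ).1 A
  have hspan : ∀ ℓ A, ∃ c : ℂ, c • R ℓ = P ℓ A := fun ℓ A =>
    peripheral_simple hE hErg (hnorm ℓ) (hR0 ℓ) (hR ℓ) (hrange ℓ A)
  have hker : ∀ ℓ A, P ℓ (E (A - P ℓ A)) = 0 := fun ℓ A => by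
    have h1 : A - P ℓ A ∈ LinearMap.ker (P ℓ) := by
      rw [LinearMap.mem_ker, map_sub, sub_eq_zero]
      exact (LinearMap.congr_fun (hP ℓ).1 A).symm
    rw [← LinearMap.mem_ker]
    rw [(hP ℓ).2.2] at h1 ⊢
    have hle : (⨆ ν ∈ {ν : ℂ | ν ≠ ω ℓ}, Module.End.maxGenEigenspace E ν) ≤
        (⨆ ν ∈ {ν : ℂ | ν ≠ ω ℓ}, Module.End.maxGenEigenspace E ν).comap E := by
      refine iSup₂_le fun ν hν x hx => ?_
      exact Submodule.mem_iSup_of_mem ν (Submodule.mem_iSup_of_mem hν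
        (Module.End.mapsTo_maxGenEigenspace_of_comm (Commute.refl E) ν hx))
    exact hle h1
  have hcomm : ∀ ℓ A, P ℓ (E A) = ω ℓ • P ℓ A := fun ℓ A => by
    have h1 := hker ℓ A
    rw [map_sub, map_sub, sub_eq_zero, hrange, map_smul] at h1
    rw [h1]; congr 1; exact LinearMap.congr_fun (hP ℓ).1 A
  have hfun : ∀ ℓ, ∃ L : MatC n, ∀ A, P ℓ A = (Lᴴ * A).trace • R ℓ := fun ℓ => by
    choose c hc using hspan ℓ
    have hcinj : ∀ a b : ℂ, a • R ℓ = b • R ℓ → a = b := fun a b h =>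
      smul_left_injective ℂ (hR0 ℓ) h
    let f : MatC n →ₗ[ℂ] ℂ :=
      { toFun := c
        map_add' := fun A B => hcinj _ _ (by rw [hc, map_add, add_smul, hc, hc])
        map_smul' := fun a A => hcinj _ _ (by
          rw [hc, map_smul, RingHom.id_apply, smul_eq_mul, mul_smul, hc]) }
    obtain ⟨L, hL⟩ := trace_rep f
    exact ⟨L, fun A => by rw [← hL, ← hc]; rfl⟩
  choose L hL using hfun
  refine ⟨fun ℓ => ?_, R, L, hL, hR, fun ℓ B => ?_, fun ℓ ℓ' => ?_⟩
  · refine finrank_eq_one_iff'.2 ⟨⟨R ℓ, R ℓ, hPR ℓ⟩, fun h => hR0 ℓ (congrArg Subtype.val h), ?_⟩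
    rintro ⟨_, A, rfl⟩
    obtain ⟨c, hc⟩ := hspan ℓ A
    exact ⟨c, Subtype.ext hc⟩
  · refine smul_left_injective ℂ (hR0 ℓ) ?_
    show _ • R ℓ = _ • R ℓ
    rw [← hL, hcomm, mul_smul, ← hL]
  · refine smul_left_injective ℂ (hR0 ℓ) ?_
    show _ • R ℓ = _ • R ℓ
    rw [← hL]
    split_ifs with h
    · subst h; rw [hPR, one_smul]
    · rw [zero_smul, ← LinearMap.mem_ker, (hP ℓ).2.2]
      exact Submodule.mem_iSup_of_mem (ω ℓ') (Submodule.mem_iSup_of_mem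
        (fun h' => h (hinj _ _ h').symm) (hRm ℓ'))
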